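/- arXiv:2105.00155 — 3 statements merged into one kernel-verified Lean document; each statement's English description precedes it below -/
import Mathlib

section
/- Fix a user κ ∈ {1,…,N} with N ≥ 1. Under the product measure on Ω = (Fin N → Fin m) with i.i.d. coordinates of law ρ, the probability of the Full-Duplex Transceiver (FDTR) event {r ∈ Ω : r(κ) ∈ {1,…,N}\{κ} and ∃ τ ≠ κ, r(τ) = κ} equals (P_hit − ρ_κ)(1 − (1 − ρ_κ)^{N−1}), where P_hit = Σ_{ℓ=1}^N ρ_ℓ. Consequently, the probability that a uniformly chosen user operates in FDTR mode equals (1/N) Σ_{κ=1}^N (P_hit − ρ_κ)(1 − (1 − ρ_κ)^{N−1}). -/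
open Finset

open scoped Classical

/-- Zipf popularity: content `κ` (0-indexed, representing content `κ+1`) has
popularity `(κ+1)^{-γ} / ∑_{η=1}^m η^{-γ}`. -/
noncomputable def zipf (m : ℕ) (γ : ℝ) (κ : Fin m) : ℝ :=
  (((κ : ℕ) : ℝ) + 1) ^ (-γ) / ∑ η : Fin m, (((η : ℕ) : ℝ) + 1) ^ (-γ)

/-- Probability of the event `E` on `Ω = (Fin N → Fin m)` under the product measure in
which each coordinate is i.i.d. with probability mass function `ρ`. -/
noncomputable def prob {N m : ℕ} (ρ : Fin m → ℝ) (E : (Fin N → Fin m) → Prop) : ℝ :=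
  ∑ r : Fin N → Fin m, if E r then ∏ τ : Fin N, ρ (r τ) else 0

theorem sum_zipf {m : ℕ} (hm : 0 < m) (γ : ℝ) : ∑ x, zipf m γ x = 1 := by
  have : Nonempty (Fin m) := ⟨⟨0, hm⟩⟩
  have h : 0 < ∑ η : Fin m, (((η : ℕ) : ℝ) + 1) ^ (-γ) :=
    Finset.sum_pos (fun _ _ => Real.rpow_pos_of_pos (by positivity) _) Finset.univ_nonempty
  simp only [zipf, ← Finset.sum_div]
  exact div_self h.ne'

theorem prob_forall {N m : ℕ} (ρ : Fin m → ℝ) (A : Fin N → Fin m → Prop) :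
    prob ρ (fun r => ∀ τ, A τ (r τ)) = ∏ τ, ∑ x, if A τ x then ρ x else 0 := by
  rw [Fintype.prod_sum, prob]
  refine Finset.sum_congr rfl fun r _ => ?_
  rw [Finset.prod_ite_zero]
  simp

theorem prob_coord_and_forall_ne {N m : ℕ} (ρ : Fin m → ℝ) (κ : Fin N) (p q : Fin m → Prop) :
    prob ρ (fun r => p (r κ) ∧ ∀ τ, τ ≠ κ → q (r τ)) =
      (∑ x, if p x then ρ x else 0) * (∑ x, if q x then ρ x else 0) ^ (N - 1) := by
  have h : (fun r : Fin N → Fin m => p (r κ) ∧ ∀ τ, τ ≠ κ → q (r τ)) =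
      fun r => ∀ τ, (fun τ x => if τ = κ then p x else q x) τ (r τ) := by
    funext r
    refine propext ⟨fun ⟨h₁, h₂⟩ τ => ?_, fun h => ⟨by simpa using h κ, fun τ hτ => ?_⟩⟩
    · by_cases hτ : τ = κ
      · subst hτ; simpa using h₁
      · simpa [hτ] using h₂ τ hτ
    · simpa [hτ] using h τ
  rw [h, prob_forall ρ (fun τ x => if τ = κ then p x else q x), ← Finset.mul_prod_erase _ _ (Finset.mem_univ κ)]
  congr 1
  · simp
  · rw [Finset.prod_congr rfl (g := fun _ => ∑ x, if q x then ρ x else 0)]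
    · simp
    · intro τ hτ
      simp [Finset.ne_of_mem_erase hτ]

theorem prob_and_eq_sub {N m : ℕ} (ρ : Fin m → ℝ) (E F : (Fin N → Fin m) → Prop) :
    prob ρ (fun r => E r ∧ F r) = prob ρ E - prob ρ (fun r => E r ∧ ¬ F r) := by
  simp only [prob, ← Finset.sum_sub_distrib]
  refine Finset.sum_congr rfl fun r _ => ?_
  by_cases hE : E r <;> by_cases hF : F r <;> simp [hE, hF]

theorem sum_ite_ne {m : ℕ} (ρ : Fin m → ℝ) (c : Fin m) :
    (∑ x, if x ≠ c then ρ x else 0) = (∑ x, ρ x) - ρ c := by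
  rw [← Finset.sum_filter, Finset.filter_ne', Finset.sum_erase_eq_sub (Finset.mem_univ c)]

theorem sum_ite_lt {N m : ℕ} (hNm : N ≤ m) (ρ : Fin m → ℝ) :
    (∑ x : Fin m, if (x : ℕ) < N then ρ x else 0) = ∑ ℓ : Fin N, ρ (Fin.castLE hNm ℓ) := by
  rw [← Finset.sum_filter]
  symm
  refine Finset.sum_bij (fun ℓ _ => Fin.castLE hNm ℓ) (by simp) (by simp) ?_ (by simp)
  intro x hx
  exact ⟨⟨x, by simpa using hx⟩, by simp, rfl⟩

theorem sum_ite_lt_and_ne {N m : ℕ} (hNm : N ≤ m) (ρ : Fin m → ℝ) (κ : Fin N) :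
    (∑ x : Fin m, if (x : ℕ) < N ∧ x ≠ Fin.castLE hNm κ then ρ x else 0) =
      (∑ ℓ : Fin N, ρ (Fin.castLE hNm ℓ)) - ρ (Fin.castLE hNm κ) := by
  have h := sum_ite_ne (fun x : Fin m => if (x : ℕ) < N then ρ x else 0) (Fin.castLE hNm κ)
  rw [sum_ite_lt hNm] at h
  simp only [Fin.val_castLE, κ.isLt, if_true] at h
  rw [← h]
  refine Finset.sum_congr rfl fun x _ => ?_
  by_cases h₁ : (x : ℕ) < N <;> by_cases h₂ : x = Fin.castLE hNm κ <;> simp [h₁, h₂]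

theorem prob_hit_other_and_requested {N m : ℕ} (hNm : N ≤ m) (ρ : Fin m → ℝ)
    (hρ : ∑ x, ρ x = 1) (κ : Fin N) :
    prob ρ (fun r => (((r κ : Fin m) : ℕ) < N ∧ r κ ≠ Fin.castLE hNm κ) ∧
        ∃ τ : Fin N, τ ≠ κ ∧ r τ = Fin.castLE hNm κ)
      = ((∑ ℓ : Fin N, ρ (Fin.castLE hNm ℓ)) - ρ (Fin.castLE hNm κ)) *
          (1 - (1 - ρ (Fin.castLE hNm κ)) ^ (N - 1)) := by
  set c := Fin.castLE hNm κ
  have hp := sum_ite_lt_and_ne hNm ρ κ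
  have hq := sum_ite_ne ρ c
  have hE : prob ρ (fun r => ((r κ : Fin m) : ℕ) < N ∧ r κ ≠ c) =
      (∑ ℓ : Fin N, ρ (Fin.castLE hNm ℓ)) - ρ c := by
    rw [← hp]
    have h := prob_coord_and_forall_ne ρ κ (fun x => (x : ℕ) < N ∧ x ≠ c) (fun _ => True)
    simp only [if_true, hρ, one_pow, mul_one, implies_true, and_true] at h
    convert h
  have hEF : prob ρ (fun r => (((r κ : Fin m) : ℕ) < N ∧ r κ ≠ c) ∧ ∀ τ, τ ≠ κ → r τ ≠ c) =
      ((∑ ℓ : Fin N, ρ (Fin.castLE hNm ℓ)) - ρ c) * (1 - ρ c) ^ (N - 1) := by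
    rw [← hρ, ← hp, ← hq]
    convert prob_coord_and_forall_ne ρ κ (fun x => (x : ℕ) < N ∧ x ≠ c) (fun x => x ≠ c)
  rw [prob_and_eq_sub, hE]
  simp only [not_exists, not_and]
  rw [hEF]
  ring

/-- FDTR mode: user `κ`'s requested content is cached by another user, and at least one
other user requests content `κ`. Its probability is `(P_hit - ρ_κ)(1 - (1-ρ_κ)^(N-1))`,
and the probability that a uniformly chosen user operates in FDTR mode is the average. -/
theorem prob_FDTR (m N : ℕ) (γr : ℝ) (hγr : 0 < γr)
    (hN : 1 ≤ N) (hNm : N ≤ m) (ρ : Fin m → ℝ) (hρ : ρ = zipf m γr) (κ : Fin N) :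
    prob ρ (fun r => (((r κ : Fin m) : ℕ) < N ∧ r κ ≠ Fin.castLE hNm κ) ∧
        ∃ τ : Fin N, τ ≠ κ ∧ r τ = Fin.castLE hNm κ)
      = ((∑ ℓ : Fin N, ρ (Fin.castLE hNm ℓ)) - ρ (Fin.castLE hNm κ)) *
          (1 - (1 - ρ (Fin.castLE hNm κ)) ^ (N - 1))
    ∧ (1 / (N : ℝ)) * ∑ κ' : Fin N,
        prob ρ (fun r => (((r κ' : Fin m) : ℕ) < N ∧ r κ' ≠ Fin.castLE hNm κ') ∧
          ∃ τ : Fin N, τ ≠ κ' ∧ r τ = Fin.castLE hNm κ')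
      = (1 / (N : ℝ)) * ∑ κ' : Fin N,
          ((∑ ℓ : Fin N, ρ (Fin.castLE hNm ℓ)) - ρ (Fin.castLE hNm κ')) *
            (1 - (1 - ρ (Fin.castLE hNm κ')) ^ (N - 1)) := by
  subst hρ
  have h := prob_hit_other_and_requested hNm (zipf m γr) (sum_zipf (hN.trans hNm) γr)
  exact ⟨h κ, by simp only [h]⟩
end

section
/- Fix a user κ ∈ {1,…,N} with N ≥ 2. Under the product measure on Ω = (Fin N → Fin m) with i.i.d. coordinates of law ρ, the probability of the Bi-directional Full-Duplex (BFD) event {r ∈ Ω : ∃ ν ∈ {1,…,N}\{κ}, r(κ) = ν and r(ν) = κ} equals (P_hit − ρ_κ) ρ_κ, where P_hit = Σ_{ℓ=1}^N ρ_ℓ. Consequently, the probability that a uniformly chosen user operates in BFD mode equals (1/N) Σ_{κ=1}^N (P_hit − ρ_κ) ρ_κ. -/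
open Finset

open scoped Classical

theorem sum_zipf_eq_one {m : ℕ} (γ : ℝ) (hm : 0 < m) : ∑ x, zipf m γ x = 1 := by
  have : Nonempty (Fin m) := ⟨⟨0, hm⟩⟩
  have hpos : 0 < ∑ η : Fin m, (((η : ℕ) : ℝ) + 1) ^ (-γ) :=
    Finset.sum_pos (fun η _ => by positivity) Finset.univ_nonempty
  simp only [zipf]
  rw [← Finset.sum_div, div_self hpos.ne']

theorem prob_forall_mem {N m : ℕ} (ρ : Fin m → ℝ) (t : Fin N → Finset (Fin m)) :
    prob ρ (fun r => ∀ τ, r τ ∈ t τ) = ∏ τ, ∑ x ∈ t τ, ρ x := by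
  rw [Finset.prod_univ_sum, prob]
  symm
  refine Finset.sum_subset_zero_on_sdiff (Finset.subset_univ _) (fun r hr => ?_) fun r hr => ?_
  · exact if_neg fun h => (Finset.mem_sdiff.1 hr).2 (Fintype.mem_piFinset.2 h)
  · exact (if_pos (Fintype.mem_piFinset.1 hr)).symm

theorem prob_eq_and_eq {N m : ℕ} {ρ : Fin m → ℝ} (hρ : ∑ x, ρ x = 1) {a b : Fin N}
    (hab : a ≠ b) (x y : Fin m) :
    prob ρ (fun r => r a = x ∧ r b = y) = ρ x * ρ y := by
  set t : Fin N → Finset (Fin m) :=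
    fun τ => if τ = a then {x} else if τ = b then {y} else Finset.univ with ht
  have hE : (fun r : Fin N → Fin m => r a = x ∧ r b = y) = fun r => ∀ τ, r τ ∈ t τ := by
    funext r
    refine propext ⟨fun h τ => ?_, fun h => ⟨?_, ?_⟩⟩
    · by_cases h1 : τ = a
      · subst h1; simp [ht, h.1]
      · by_cases h2 : τ = b
        · subst h2; simp [ht, h1, h.2]
        · simp [ht, h1, h2]
    · simpa [ht] using h a
    · simpa [ht, hab.symm] using h b
  rw [hE, prob_forall_mem, ← Finset.prod_subset (Finset.subset_univ {a, b}),
    Finset.prod_pair hab]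
  · simp [ht, hab.symm]
  · intro τ _ hτ
    simp only [Finset.mem_insert, Finset.mem_singleton, not_or] at hτ
    simp [ht, hτ.1, hτ.2, hρ]

/-- Finite additivity of `prob` over pairwise incompatible events. -/
theorem prob_exists_mem {N m : ℕ} {ι : Type*} (ρ : Fin m → ℝ) (s : Finset ι)
    (E : ι → (Fin N → Fin m) → Prop)
    (hE : ∀ r, ∀ i ∈ s, ∀ j ∈ s, E i r → E j r → i = j) :
    prob ρ (fun r => ∃ i ∈ s, E i r) = ∑ i ∈ s, prob ρ (E i) := by
  simp only [prob]
  rw [Finset.sum_comm]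
  refine Finset.sum_congr rfl fun r _ => ?_
  by_cases h : ∃ i ∈ s, E i r
  · obtain ⟨i, hi, hir⟩ := h
    rw [if_pos ⟨i, hi, hir⟩, Finset.sum_eq_single_of_mem i hi, if_pos hir]
    exact fun j hj hji => if_neg fun hjr => hji (hE r j hj i hi hjr hir)
  · rw [if_neg h, Finset.sum_eq_zero]
    exact fun i hi => if_neg fun hir => h ⟨i, hi, hir⟩

theorem prob_exists_swap {N m : ℕ} {ρ : Fin m → ℝ} (hρ : ∑ x, ρ x = 1) {c : Fin N → Fin m}
    (hc : Function.Injective c) (κ : Fin N) :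
    prob ρ (fun r => ∃ ν : Fin N, ν ≠ κ ∧ r κ = c ν ∧ r ν = c κ)
      = ((∑ ℓ, ρ (c ℓ)) - ρ (c κ)) * ρ (c κ) := by
  have hE : (fun r : Fin N → Fin m => ∃ ν : Fin N, ν ≠ κ ∧ r κ = c ν ∧ r ν = c κ)
      = fun r => ∃ ν ∈ Finset.univ.erase κ, r κ = c ν ∧ r ν = c κ := by
    simp
  rw [hE, prob_exists_mem ρ (Finset.univ.erase κ) (fun ν r => r κ = c ν ∧ r ν = c κ)
    fun r i _ j _ hi hj => hc (hi.1.symm.trans hj.1),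
    Finset.sum_congr rfl fun ν hν => prob_eq_and_eq hρ (Finset.ne_of_mem_erase hν).symm _ _,
    ← Finset.sum_mul, Finset.sum_erase_eq_sub (Finset.mem_univ κ)]

/-- BFD mode: there is another user `ν` such that user `κ` requests the content cached
by `ν` and simultaneously user `ν` requests the content cached by `κ`. Its probability
is `(P_hit - ρ_κ) ρ_κ`, and the probability that a uniformly chosen user operates in
BFD mode is the average. -/
theorem prob_BFD (m N : ℕ) (γr : ℝ) (hγr : 0 < γr)
    (hN : 2 ≤ N) (hNm : N ≤ m) (ρ : Fin m → ℝ) (hρ : ρ = zipf m γr) (κ : Fin N) :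
    prob ρ (fun r => ∃ ν : Fin N, ν ≠ κ ∧
        r κ = Fin.castLE hNm ν ∧ r ν = Fin.castLE hNm κ)
      = ((∑ ℓ : Fin N, ρ (Fin.castLE hNm ℓ)) - ρ (Fin.castLE hNm κ)) * ρ (Fin.castLE hNm κ)
    ∧ (1 / (N : ℝ)) * ∑ κ' : Fin N,
        prob ρ (fun r => ∃ ν : Fin N, ν ≠ κ' ∧
          r κ' = Fin.castLE hNm ν ∧ r ν = Fin.castLE hNm κ')
      = (1 / (N : ℝ)) * ∑ κ' : Fin N,
          ((∑ ℓ : Fin N, ρ (Fin.castLE hNm ℓ)) - ρ (Fin.castLE hNm κ')) *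
            ρ (Fin.castLE hNm κ') := by
  have hsum : ∑ x, ρ x = 1 := hρ ▸ sum_zipf_eq_one γr (by omega)
  have hBFD := prob_exists_swap hsum (Fin.castLE_injective hNm)
  exact ⟨hBFD κ, congrArg _ (Finset.sum_congr rfl fun κ' _ => hBFD κ')⟩
end

section
/- Fix a user κ ∈ {1,…,N} with N ≥ 1. Under the product measure on Ω = (Fin N → Fin m) with i.i.d. coordinates of law ρ, the probability of the half-duplex event, defined as the disjoint union of the SR-HDTX event {r(κ)=κ ∧ ∃τ≠κ, r(τ)=κ}, the HDRX event {r(κ)∈{1,…,N}\{κ} ∧ ∀τ≠κ, r(τ)≠κ}, and the HDTX event {r(κ)∉{1,…,N} ∧ ∃τ≠κ, r(τ)=κ}, equals ρ_κ(1−(1−ρ_κ)^{N−1}) + (P_hit−ρ_κ)(1−ρ_κ)^{N−1} + (1−P_hit)(1−(1−ρ_κ)^{N−1}), where P_hit = Σ_{ℓ=1}^N ρ_ℓ. -/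
open Finset

open scoped Classical

/-- Total mass that `ρ` assigns to the elements satisfying `A`. -/
noncomputable def mass {ι : Type*} [Fintype ι] (ρ : ι → ℝ) (A : ι → Prop) : ℝ :=
  ∑ x, if A x then ρ x else 0

theorem mass_eq_sum_filter {ι : Type*} [Fintype ι] (ρ : ι → ℝ) (A : ι → Prop)
    [DecidablePred A] : mass ρ A = ∑ x with A x, ρ x := by
  rw [Finset.sum_filter]
  refine Finset.sum_congr rfl fun x _ => ?_
  congr

/-- Disjoint events have additive probability. -/
theorem prob_or {N m : ℕ} (ρ : Fin m → ℝ) {E F : (Fin N → Fin m) → Prop}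
    (h : ∀ r, ¬ (E r ∧ F r)) : prob ρ (fun r => E r ∨ F r) = prob ρ E + prob ρ F := by
  unfold prob
  rw [← Finset.sum_add_distrib]
  refine Finset.sum_congr rfl fun r _ => ?_
  have := h r
  by_cases hE : E r <;> by_cases hF : F r <;> simp_all

/-- Probability of a product event constraining one coordinate by `A` and all others by `B`. -/
theorem prob_and_forall_ne {N m : ℕ} (ρ : Fin m → ℝ) (κ : Fin N) (A B : Fin m → Prop) :
    prob ρ (fun r => A (r κ) ∧ ∀ τ, τ ≠ κ → B (r τ))
      = mass ρ A * mass ρ B ^ (N - 1) := by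
  unfold mass
  have hprod := Finset.prod_univ_sum (fun _ : Fin N => (univ : Finset (Fin m)))
    (fun τ x => if (if τ = κ then A x else B x) then ρ x else 0)
  rw [Fintype.piFinset_univ, ← Finset.mul_prod_erase univ _ (mem_univ κ)] at hprod
  have herase : ∏ τ ∈ univ.erase κ,
      (∑ x, if (if τ = κ then A x else B x) then ρ x else 0)
        = (∑ x, if B x then ρ x else 0) ^ (N - 1) := by
    rw [Finset.prod_congr rfl (g := fun _ => ∑ x, if B x then ρ x else 0)
      (fun τ hτ => by simp [Finset.ne_of_mem_erase hτ])]
    simp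
  rw [herase] at hprod
  simp only [if_true] at hprod
  rw [hprod]
  unfold prob
  refine Finset.sum_congr rfl fun r _ => ?_
  rw [Finset.prod_ite_zero]
  have hiff : (A (r κ) ∧ ∀ τ, τ ≠ κ → B (r τ))
      ↔ ∀ τ ∈ univ, if τ = κ then A (r τ) else B (r τ) := by
    constructor
    · rintro ⟨hA, hB⟩ τ -
      split_ifs with h
      · exact h ▸ hA
      · exact hB τ h
    · intro h
      exact ⟨by simpa using h κ (mem_univ _), fun τ hτ => by simpa [hτ] using h τ (mem_univ _)⟩
  by_cases h : ∀ τ ∈ univ, if τ = κ then A (r τ) else B (r τ)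
  · rw [if_pos (hiff.2 h), if_pos h]
  · rw [if_neg (hiff.not.2 h), if_neg h]

theorem prob_and_exists_ne {N m : ℕ} {ρ : Fin m → ℝ} (hρ : ∑ x, ρ x = 1) (κ : Fin N)
    (A B : Fin m → Prop) :
    prob ρ (fun r => A (r κ) ∧ ∃ τ, τ ≠ κ ∧ B (r τ))
      = mass ρ A * (1 - mass ρ (fun x => ¬ B x) ^ (N - 1)) := by
  have hA := prob_and_forall_ne ρ κ A (fun _ => True)
  have hsplit := prob_or ρ (E := fun r : Fin N → Fin m => A (r κ) ∧ ∃ τ, τ ≠ κ ∧ B (r τ))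
    (F := fun r => A (r κ) ∧ ∀ τ, τ ≠ κ → ¬ B (r τ))
    (by rintro r ⟨⟨-, τ, hτ, h⟩, -, hn⟩; exact hn τ hτ h)
  rw [prob_and_forall_ne ρ κ A (fun x => ¬ B x)] at hsplit
  have hevent : (fun r : Fin N → Fin m => (A (r κ) ∧ ∃ τ, τ ≠ κ ∧ B (r τ))
      ∨ A (r κ) ∧ ∀ τ, τ ≠ κ → ¬ B (r τ))
        = fun r => A (r κ) ∧ ∀ τ, τ ≠ κ → True := by
    funext r
    have : (∃ τ, τ ≠ κ ∧ B (r τ)) ∨ ∀ τ, τ ≠ κ → ¬ B (r τ) := by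
      by_cases h : ∃ τ, τ ≠ κ ∧ B (r τ)
      · exact Or.inl h
      · exact Or.inr fun τ hτ hB => h ⟨τ, hτ, hB⟩
    rw [← and_or_left]
    simp only [this, implies_true]
  rw [hevent, hA] at hsplit
  have htrue : mass ρ (fun _ => True) = 1 := by simp [mass, hρ]
  rw [htrue, one_pow, mul_one] at hsplit
  linarith

theorem mass_not {ι : Type*} [Fintype ι] (ρ : ι → ℝ) (A : ι → Prop) :
    mass ρ (fun x => ¬ A x) = (∑ x, ρ x) - mass ρ A := by
  unfold mass
  rw [← Finset.sum_sub_distrib]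
  refine Finset.sum_congr rfl fun x _ => ?_
  by_cases h : A x <;> simp [h]

theorem mass_eq {ι : Type*} [Fintype ι] (ρ : ι → ℝ) (c : ι) :
    mass ρ (fun x => x = c) = ρ c := by
  simp [mass]

theorem mass_val_lt {N m : ℕ} (h : N ≤ m) (ρ : Fin m → ℝ) :
    mass ρ (fun x => (x : ℕ) < N) = ∑ ℓ : Fin N, ρ (Fin.castLE h ℓ) := by
  rw [mass_eq_sum_filter]
  symm
  refine Finset.sum_bij (fun ℓ _ => Fin.castLE h ℓ) ?_ ?_ ?_ ?_
  · intro ℓ _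
    simp
  · intro a _ b _ hab
    exact Fin.castLE_injective h hab
  · intro x hx
    exact ⟨⟨x, (mem_filter.1 hx).2⟩, mem_univ _, rfl⟩
  · intro ℓ _
    rfl

theorem mass_and_ne {ι : Type*} [Fintype ι] (ρ : ι → ℝ) {A : ι → Prop} {c : ι} (hc : A c) :
    mass ρ (fun x => A x ∧ x ≠ c) = mass ρ A - ρ c := by
  rw [← mass_eq ρ c]
  unfold mass
  rw [← Finset.sum_sub_distrib]
  refine Finset.sum_congr rfl fun x _ => ?_
  by_cases h : x = c
  · simp [h, hc]
  · simp [h]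

/-- The half-duplex event is the disjoint union of the SR-HDTX, HDRX, and HDTX events,
and its probability equals
`ρ_κ(1-(1-ρ_κ)^(N-1)) + (P_hit-ρ_κ)(1-ρ_κ)^(N-1) + (1-P_hit)(1-(1-ρ_κ)^(N-1))`. -/
theorem prob_HD (m N : ℕ) (γr : ℝ) (hγr : 0 < γr)
    (hN : 1 ≤ N) (hNm : N ≤ m) (ρ : Fin m → ℝ) (hρ : ρ = zipf m γr) (κ : Fin N) :
    (∀ r : Fin N → Fin m,
        ¬ ((r κ = Fin.castLE hNm κ ∧ ∃ τ : Fin N, τ ≠ κ ∧ r τ = Fin.castLE hNm κ)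
          ∧ ((((r κ : Fin m) : ℕ) < N ∧ r κ ≠ Fin.castLE hNm κ) ∧
              ∀ τ : Fin N, τ ≠ κ → r τ ≠ Fin.castLE hNm κ))
      ∧ ¬ ((r κ = Fin.castLE hNm κ ∧ ∃ τ : Fin N, τ ≠ κ ∧ r τ = Fin.castLE hNm κ)
          ∧ (¬ (((r κ : Fin m) : ℕ) < N) ∧
              ∃ τ : Fin N, τ ≠ κ ∧ r τ = Fin.castLE hNm κ))
      ∧ ¬ (((((r κ : Fin m) : ℕ) < N ∧ r κ ≠ Fin.castLE hNm κ) ∧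
              ∀ τ : Fin N, τ ≠ κ → r τ ≠ Fin.castLE hNm κ)
          ∧ (¬ (((r κ : Fin m) : ℕ) < N) ∧
              ∃ τ : Fin N, τ ≠ κ ∧ r τ = Fin.castLE hNm κ)))
    ∧ prob ρ (fun r =>
          (r κ = Fin.castLE hNm κ ∧ ∃ τ : Fin N, τ ≠ κ ∧ r τ = Fin.castLE hNm κ)
        ∨ ((((r κ : Fin m) : ℕ) < N ∧ r κ ≠ Fin.castLE hNm κ) ∧
            ∀ τ : Fin N, τ ≠ κ → r τ ≠ Fin.castLE hNm κ)
        ∨ (¬ (((r κ : Fin m) : ℕ) < N) ∧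
            ∃ τ : Fin N, τ ≠ κ ∧ r τ = Fin.castLE hNm κ))
      = ρ (Fin.castLE hNm κ) * (1 - (1 - ρ (Fin.castLE hNm κ)) ^ (N - 1))
        + ((∑ ℓ : Fin N, ρ (Fin.castLE hNm ℓ)) - ρ (Fin.castLE hNm κ)) *
            (1 - ρ (Fin.castLE hNm κ)) ^ (N - 1)
        + (1 - ∑ ℓ : Fin N, ρ (Fin.castLE hNm ℓ)) *
            (1 - (1 - ρ (Fin.castLE hNm κ)) ^ (N - 1)) := by
  have hsum : ∑ x, ρ x = 1 := by
    rw [hρ]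
    exact sum_zipf (by omega) γr
  set c := Fin.castLE hNm κ with hc
  have hcN : (c : ℕ) < N := by simp [hc]
  refine ⟨fun r => ⟨?_, ?_, ?_⟩, ?_⟩
  · rintro ⟨⟨h, -⟩, ⟨-, h'⟩, -⟩
    exact h' h
  · rintro ⟨⟨h, -⟩, h', -⟩
    exact h' (h ▸ hcN)
  · rintro ⟨⟨⟨h, -⟩, -⟩, h', -⟩
    exact h' h
  · rw [prob_or, prob_or,
      prob_and_exists_ne hsum κ (fun x => x = c) (fun x => x = c),
      prob_and_forall_ne ρ κ (fun x => (x : ℕ) < N ∧ x ≠ c) (fun x => x ≠ c),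
      prob_and_exists_ne hsum κ (fun x => ¬ (x : ℕ) < N) (fun x => x = c)]
    · have hne : mass ρ (fun x => x ≠ c) = 1 - ρ c := by
        rw [← hsum, ← mass_eq ρ c, ← mass_not]
      rw [mass_and_ne ρ (A := fun x : Fin m => (x : ℕ) < N) hcN, hne, mass_not,
        mass_eq, mass_val_lt hNm, hsum]
      ring
    · rintro r ⟨⟨⟨h, -⟩, -⟩, h', -⟩
      exact h' h
    · rintro r ⟨⟨h, -⟩, ⟨⟨-, h'⟩, -⟩ | ⟨h', -⟩⟩
      · exact h' h
      · exact h' (h ▸ hcN)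
end
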